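/- Suppose Assumptions 1 and 2 hold. Let x ∈ ℝⁿ with x ≠ 0 and let e be such that V(x) ≥ η̂_j(‖e_j‖) for every j ∈ {1,…,N}. Then for every index i at which the maximum defining V(x) is attained (i.e. V(x) = σ_i⁻¹(V_i(x_i))), one has ∇V_i(x_i)·f_i(x, g_i(x + e)) ≤ −α_i(‖x_i‖). -/

import Mathlib

/-- A function `f : [0,∞) → [0,∞)` is of class K if it is continuous, strictly
increasing and `f 0 = 0`. -/
def ClassK (f : ℝ → ℝ) : Prop :=
  ContinuousOn f (Set.Ici 0) ∧ StrictMonoOn f (Set.Ici 0) ∧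
    (∀ r, 0 ≤ r → 0 ≤ f r) ∧ f 0 = 0

/-- A function is of class K∞ if it is of class K and unbounded. -/
def ClassKInf (f : ℝ → ℝ) : Prop :=
  ClassK f ∧ Filter.Tendsto f Filter.atTop Filter.atTop

/-- A continuous positive definite function `[0,∞) → [0,∞)`: vanishing exactly at 0. -/
def PosDefFun (f : ℝ → ℝ) : Prop :=
  ContinuousOn f (Set.Ici 0) ∧ (∀ r, 0 ≤ r → 0 ≤ f r) ∧
    (∀ r, 0 ≤ r → (f r = 0 ↔ r = 0))

/-- A monotone aggregation function on `[0,∞)^m`: continuous, nonnegative, positive on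
nonzero nonnegative vectors, strictly increasing componentwise, and unbounded. -/
def MAF {m : ℕ} (μ : (Fin m → ℝ) → ℝ) : Prop :=
  Continuous μ ∧
    (∀ v : Fin m → ℝ, (∀ k, 0 ≤ v k) → 0 ≤ μ v) ∧
    (∀ v : Fin m → ℝ, (∀ k, 0 ≤ v k) → v ≠ 0 → 0 < μ v) ∧
    (∀ v z : Fin m → ℝ, (∀ k, z k < v k) → μ z < μ v) ∧
    (∀ M : ℝ, ∃ R : ℝ, ∀ v : Fin m → ℝ, (∀ k, 0 ≤ v k) → R ≤ ‖v‖ → M ≤ μ v)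

/-- A monotone aggregation function is monotone for the weak componentwise order. -/
theorem MAF.monotone {m : ℕ} {μ : (Fin m → ℝ) → ℝ} (h : MAF μ) : Monotone μ := by
  intro z v hzv
  have hlim : Filter.Tendsto (fun ε : ℝ => μ (fun k => v k + ε)) (nhdsWithin 0 (Set.Ioi 0))
      (nhds (μ v)) := by
    have hc : Continuous (fun ε : ℝ => μ (fun k => v k + ε)) := h.1.comp (by fun_prop)
    have h0 := hc.tendsto 0
    simp only [add_zero] at h0
    exact h0.mono_left nhdsWithin_le_nhds
  refine ge_of_tendsto hlim ?_
  filter_upwards [self_mem_nhdsWithin] with ε hε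
  refine (h.2.2.2.1 _ _ fun k => ?_).le
  have := hzv k
  have : (0 : ℝ) < ε := hε
  linarith

theorem ClassK.monotoneOn {f : ℝ → ℝ} (h : ClassK f) : MonotoneOn f (Set.Ici 0) :=
  h.2.1.monotoneOn

theorem ClassK.pos {f : ℝ → ℝ} (h : ClassK f) {r : ℝ} (hr : 0 < r) : 0 < f r := by
  have := h.2.1 (Set.mem_Ici.2 le_rfl) (Set.mem_Ici.2 hr.le) hr
  rwa [h.2.2.2] at this

/-- A class K∞ function maps `[0,∞)` onto `[0,∞)`. -/
theorem ClassKInf.exists_eq {f : ℝ → ℝ} (h : ClassKInf f) {y : ℝ} (hy : 0 ≤ y) :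
    ∃ r, 0 ≤ r ∧ f r = y := by
  obtain ⟨b, hb, hyb⟩ := ((Filter.eventually_ge_atTop (0 : ℝ)).and
    (h.2.eventually_ge_atTop y)).exists
  obtain ⟨r, hr, hfr⟩ := intermediate_value_Icc hb (h.1.1.mono Set.Icc_subset_Ici_self)
    (show y ∈ Set.Icc (f 0) (f b) from ⟨h.1.2.2.2.symm ▸ hy, hyb⟩)
  exact ⟨r, hr.1, hfr⟩

/-- A left inverse on `[0,∞)` of a class K∞ function is nonnegative on `[0,∞)`. -/
theorem ClassKInf.leftInverse_nonneg {f g : ℝ → ℝ} (h : ClassKInf f)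
    (hg : ∀ r, 0 ≤ r → g (f r) = r) {y : ℝ} (hy : 0 ≤ y) : 0 ≤ g y := by
  obtain ⟨r, hr, rfl⟩ := h.exists_eq hy
  rwa [hg r hr]

/-- **Theorem 4 (variant of Theorem 1) of the paper.** Under Assumptions 1 and 2, if
`x ≠ 0` and `V(x) ≥ η̂_j(‖e_j‖)` for every `j`, where
`η̂_j = max_{i : η_{ij} ≢ 0} φ_{ij}⁻¹ ∘ η_{ij}` and `V(x) = max_k σ_k⁻¹(V_k(x_k))`,
then for every index `i` attaining the maximum defining `V(x)` one has
`∇V_i(x_i)·f_i(x, g_i(x + e)) ≤ −α_i(‖x_i‖)`. -/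
theorem statement2
    (N : ℕ) (hN : 0 < N)
    (n m : Fin N → ℕ)
    (f : ∀ i : Fin N, (∀ j, EuclideanSpace ℝ (Fin (n j))) →
      EuclideanSpace ℝ (Fin (m i)) → EuclideanSpace ℝ (Fin (n i)))
    (g : ∀ i : Fin N, (∀ j, EuclideanSpace ℝ (Fin (n j))) → EuclideanSpace ℝ (Fin (m i)))
    (V : ∀ i : Fin N, EuclideanSpace ℝ (Fin (n i)) → ℝ)
    (α₁ α₂ : Fin N → ℝ → ℝ)
    (μ : Fin N → (Fin (N + N) → ℝ) → ℝ)
    (γ η φ φinv : Fin N → Fin N → ℝ → ℝ)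
    (αpd : Fin N → ℝ → ℝ)
    (σ σinv : Fin N → ℝ → ℝ)
    (ηhat : Fin N → ℝ → ℝ)
    -- Assumption 1
    (hVdiff : ∀ i, Differentiable ℝ (V i))
    (hα₁ : ∀ i, ClassKInf (α₁ i)) (hα₂ : ∀ i, ClassKInf (α₂ i))
    (hVbd : ∀ i xi, α₁ i ‖xi‖ ≤ V i xi ∧ V i xi ≤ α₂ i ‖xi‖)
    (hμ : ∀ i, MAF (μ i))
    (hγ : ∀ i j, ClassKInf (γ i j) ∨ γ i j = 0)
    (hγdiag : ∀ i, γ i i = 0)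
    (hη : ∀ i j, ClassKInf (η i j) ∨ η i j = 0)
    (hαpd : ∀ i, PosDefFun (αpd i))
    (hA1 : ∀ i (x e : ∀ j, EuclideanSpace ℝ (Fin (n j))),
      μ i (Fin.append (fun j => γ i j (V j (x j))) (fun j => η i j ‖e j‖)) ≤ V i (x i) →
      fderiv ℝ (V i) (x i) (f i x (g i (x + e))) ≤ -(αpd i ‖x i‖))
    -- Assumption 2
    (hσ : ∀ i, ClassKInf (σ i))
    (hσinv : ∀ i r, 0 ≤ r → σinv i (σ i r) = r ∧ σ i (σinv i r) = r)
    (hφ : ∀ i j, (η i j ≠ 0 → ClassKInf (φ i j)) ∧ (η i j = 0 → φ i j = 0))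
    (hφinv : ∀ i j, η i j ≠ 0 → ∀ r, 0 ≤ r → φinv i j (φ i j r) = r ∧ φ i j (φinv i j r) = r)
    (hA2 : ∀ i, ∀ r > (0 : ℝ),
      μ i (Fin.append (fun j => γ i j (σ j r)) (fun j => φ i j r)) < σ i r)
    -- definition of `η̂_j`
    (hηhat : ∀ j r, ηhat j r = ⨆ i ∈ {i : Fin N | η i j ≠ 0}, φinv i j (η i j r))
    -- hypotheses on the state and the error
    (x e : ∀ j, EuclideanSpace ℝ (Fin (n j)))
    (hx : x ≠ 0)
    (he : ∀ j, ηhat j ‖e j‖ ≤ ⨆ k, σinv k (V k (x k))) :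
    ∀ i, (⨆ k, σinv k (V k (x k))) = σinv i (V i (x i)) →
      fderiv ℝ (V i) (x i) (f i x (g i (x + e))) ≤ -(αpd i ‖x i‖) := by
  intro i hi
  have hV0 : ∀ k, 0 ≤ V k (x k) := fun k =>
    ((hα₁ k).1.2.2.1 _ (norm_nonneg _)).trans (hVbd k (x k)).1
  have hσinv0 : ∀ k y, 0 ≤ y → 0 ≤ σinv k y := fun k y hy =>
    (hσ k).leftInverse_nonneg (fun r hr => (hσinv k r hr).1) hy
  set r := ⨆ k, σinv k (V k (x k))
  have hle : ∀ k, σinv k (V k (x k)) ≤ r := fun k =>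
    le_ciSup (f := fun k => σinv k (V k (x k))) (Set.finite_range _).bddAbove k
  have hrpos : 0 < r := by
    obtain ⟨k, hk⟩ := Function.ne_iff.1 hx
    have hVk : 0 < V k (x k) :=
      ((hα₁ k).1.pos (norm_pos_iff.2 hk)).trans_le (hVbd k (x k)).1
    refine lt_of_lt_of_le (lt_of_le_of_ne (hσinv0 k _ hVk.le) fun h => ?_) (hle k)
    have h2 := (hσinv k _ hVk.le).2
    rw [← h, (hσ k).1.2.2.2] at h2
    exact hVk.ne h2
  have hVσ : ∀ k, V k (x k) ≤ σ k r := fun k => by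
    rw [← (hσinv k _ (hV0 k)).2]
    exact (hσ k).1.monotoneOn (hσinv0 k _ (hV0 k)) hrpos.le (hle k)
  have hγle : ∀ j, γ i j (V j (x j)) ≤ γ i j (σ j r) := fun j => by
    rcases hγ i j with h | h
    · exact h.1.monotoneOn (hV0 j) ((hV0 j).trans (hVσ j)) (hVσ j)
    · simp [h]
  have hηle : ∀ j, η i j ‖e j‖ ≤ φ i j r := fun j => by
    by_cases h : η i j = 0
    · simp [h, (hφ i j).2 h]
    have hη0 : 0 ≤ η i j ‖e j‖ :=
      ((hη i j).resolve_right h).1.2.2.1 _ (norm_nonneg _)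
    have hφK := (hφ i j).1 h
    have hφr : φinv i j (η i j ‖e j‖) ≤ r := by
      refine le_trans ?_ (he j)
      rw [hηhat]
      refine le_trans (le_of_eq ?_) (le_ciSup
        (f := fun k => ⨆ _ : k ∈ {k : Fin N | η k j ≠ 0}, φinv k j (η k j ‖e j‖))
        (Set.finite_range _).bddAbove i)
      exact (ciSup_pos (f := fun _ => φinv i j (η i j ‖e j‖))
        (show i ∈ {k : Fin N | η k j ≠ 0} from h)).symm
    rw [← (hφinv i j h _ hη0).2]
    exact hφK.1.monotoneOn
      (hφK.leftInverse_nonneg (fun s hs => (hφinv i j h s hs).1) hη0) hrpos.le hφr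
  refine hA1 i x e ?_
  have hVi : V i (x i) = σ i r := by rw [hi, (hσinv i _ (hV0 i)).2]
  rw [hVi]
  refine ((hμ i).monotone fun k => ?_).trans (hA2 i r hrpos).le
  refine Fin.addCases (fun j => ?_) (fun j => ?_) k
  · simpa only [Fin.append_left] using hγle j
  · simpa only [Fin.append_right] using hηle j
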